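/- Every perfect cube n ≤ 10000^3 all of whose decimal digits are perfect cubes (i.e., digits in {0,1,8}) is of the form D · 10^(3k) with D ∈ {0,1,8} and k ≥ 0. -/

import Mathlib

set_option synthInstance.maxSize 1024 in
/-- If `m = 100 * q + r ≤ 10000` is not of the form `0`, `10 ^ k` or `2 * 10 ^ k`, then some
decimal digit of `m ^ 3` is not in `{0, 1, 8}`. The first hypothesis, on the last two digits,
only serves to prune the search. -/
theorem cube_digit_search : ∀ r < 100,
    (∀ i < 2, r ^ 3 / 10 ^ i % 10 = 0 ∨ r ^ 3 / 10 ^ i % 10 = 1 ∨ r ^ 3 / 10 ^ i % 10 = 8) →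
    ∀ q < 101,
    (∀ i < 12, (100 * q + r) ^ 3 / 10 ^ i % 10 = 0 ∨ (100 * q + r) ^ 3 / 10 ^ i % 10 = 1 ∨
      (100 * q + r) ^ 3 / 10 ^ i % 10 = 8) →
    100 * q + r = 0 ∨ ∃ k < 5, 100 * q + r = 10 ^ k ∨ 100 * q + r = 2 * 10 ^ k := by
  decide +kernel

/-- Every entry of the decimal expansion, padded by zeros, satisfies a property of the digits
that holds for `0`. -/
theorem div_pow_mod_of_forall_mem_digits {p : ℕ → Prop} {n : ℕ} (h0 : p 0)
    (h : ∀ d ∈ Nat.digits 10 n, p d) (i : ℕ) : p (n / 10 ^ i % 10) := by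
  rw [← Nat.getD_digits n i (by norm_num)]
  by_cases hi : i < (Nat.digits 10 n).length
  · rw [List.getD_eq_getElem _ _ hi]
    exact h _ (List.getElem_mem hi)
  · rwa [List.getD_eq_default _ _ (not_lt.mp hi)]

/-- The last two digits of `m ^ 3` depend only on the last two digits of `m`. -/
theorem mod_cube_div_pow_mod (m : ℕ) {i : ℕ} (hi : i < 2) :
    (m % 100) ^ 3 / 10 ^ i % 10 = m ^ 3 / 10 ^ i % 10 := by
  have h := Nat.pow_mod m 3 100
  interval_cases i <;> omega

theorem stmt_6 : ∀ n : ℕ, n ≤ 10000^3 → (∃ m : ℕ, n = m^3) →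
    (∀ d ∈ Nat.digits 10 n, d ∈ ({0, 1, 8} : Set ℕ)) →
    ∃ D k : ℕ, D ∈ ({0, 1, 8} : Set ℕ) ∧ n = D * 10^(3*k) := by
  rintro _ hn ⟨m, rfl⟩ hd
  have hm : m ≤ 10000 := (Nat.pow_le_pow_iff_left (by norm_num)).mp hn
  have hdigit (i : ℕ) : m ^ 3 / 10 ^ i % 10 = 0 ∨ m ^ 3 / 10 ^ i % 10 = 1 ∨
      m ^ 3 / 10 ^ i % 10 = 8 := by
    simpa using div_pow_mod_of_forall_mem_digits (p := (· ∈ ({0, 1, 8} : Set ℕ))) (by simp) hd i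
  have hsearch := cube_digit_search (m % 100) (by omega)
    (fun i hi => by rw [mod_cube_div_pow_mod m hi]; exact hdigit i) (m / 100) (by omega)
  rw [Nat.div_add_mod] at hsearch
  rcases hsearch fun i _ => hdigit i with rfl | ⟨k, -, rfl | rfl⟩
  · exact ⟨0, 0, by simp, by simp⟩
  · exact ⟨1, k, by simp, by ring⟩
  · exact ⟨8, k, by simp, by ring⟩
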